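/- Let n ≥ 1 and for each 1 ≤ k ≤ n let π_k be a policy mapping beliefs to actions in U such that π_k(b) ∈ argmax_{u∈U} Q_k(b,u) for every belief b. Define J_0(b) = 0 and, for 1 ≤ k ≤ n, J_k(b) = Σ_{s,v} b(s) Pr*(s,v) R(s, π_k(b), v) + φ Σ_{v,o} Pr_{Pr*}(v,o|b,π_k(b)) · J_{k−1}(B_{Pr*}(b, π_k(b), v, o)) (summands with Pr_{Pr*}(v,o|b,π_k(b)) = 0 taken to be 0). Then sup_b |V_n(b) − J_n(b)| ≤ ε_p |V| R_max [ φ^(n−1) + (1/(1−φ)) (1 + 3φ|O|/(1−φ)) ]; i.e., the expected reward of the greedy policy evaluated under the true strategy differs from the value function computed under the predicted strategy by at most this amount. -/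

import Mathlib

open Finset

noncomputable section

variable {S U V O : Type*}

/-- `b : S → ℝ` is a belief (probability distribution over states). -/
def IsBelief [Fintype S] (b : S → ℝ) : Prop :=
  (∀ s, 0 ≤ b s) ∧ ∑ s, b s = 1

/-- `P : S → V → ℝ` is a (mixed) strategy of the other agent. -/
def IsStrategy [Fintype V] (P : S → V → ℝ) : Prop :=
  (∀ s v, 0 ≤ P s v) ∧ ∀ s, ∑ v, P s v = 1

/-- Expected immediate payoff `R_P(b,u) = Σ_{s,v} b(s) P(s,v) R(s,u,v)`. -/
def expR [Fintype S] [Fintype V] (R : S → U → V → ℝ) (P : S → V → ℝ)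
    (b : S → ℝ) (u : U) : ℝ :=
  ∑ s, ∑ v, b s * P s v * R s u v

/-- Belief-state observation model
`Pr_P(v,o|b,u) = Σ_{s'} Z(s',u,o) Σ_s T(s,u,v,s') P(s,v) b(s)`. -/
def obsPr [Fintype S] (T : S → U → V → S → ℝ) (Z : S → U → O → ℝ)
    (P : S → V → ℝ) (b : S → ℝ) (u : U) (v : V) (o : O) : ℝ :=
  ∑ s', Z s' u o * ∑ s, T s u v s' * P s v * b s

/-- Unnormalized belief update
`F_P(b,u,v,o)(s') = Z(s',u,o) Σ_s T(s,u,v,s') P(s,v) b(s)`. -/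
def unnormUpd [Fintype S] (T : S → U → V → S → ℝ) (Z : S → U → O → ℝ)
    (P : S → V → ℝ) (b : S → ℝ) (u : U) (v : V) (o : O) (s' : S) : ℝ :=
  Z s' u o * ∑ s, T s u v s' * P s v * b s

/-- Normalized belief update `B_P(b,u,v,o)`. -/
def beliefUpd [Fintype S] (T : S → U → V → S → ℝ) (Z : S → U → O → ℝ)
    (P : S → V → ℝ) (b : S → ℝ) (u : U) (v : V) (o : O) (s' : S) : ℝ :=
  unnormUpd T Z P b u v o s' / obsPr T Z P b u v o

/-- Value function of I-POMDP Lite: `V^P_0(b) = 0` and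
`V^P_{n+1}(b) = max_u [ R_P(b,u) + φ Σ_{v,o} Pr_P(v,o|b,u) V^P_n(B_P(b,u,v,o)) ]`
(summands with `Pr_P(v,o|b,u) = 0` vanish since they are multiplied by `0`). -/
def valFun [Fintype S] [Fintype U] [Fintype V] [Fintype O] [Nonempty U]
    (T : S → U → V → S → ℝ) (Z : S → U → O → ℝ) (R : S → U → V → ℝ)
    (P : S → V → ℝ) (φ : ℝ) : ℕ → (S → ℝ) → ℝ
  | 0, _ => 0
  | n + 1, b => ⨆ u : U, (expR R P b u +
      φ * ∑ v, ∑ o, obsPr T Z P b u v o * valFun T Z R P φ n (beliefUpd T Z P b u v o))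

/-- Q-function of I-POMDP Lite: `qFun … n` is `Q^P_{n+1}`, i.e.
`Q^P_{n+1}(b,u) = R_P(b,u) + φ Σ_{v,o} Pr_P(v,o|b,u) V^P_n(B_P(b,u,v,o))`,
so that `V^P_{n+1}(b) = max_u (qFun … n b u)`. -/
def qFun [Fintype S] [Fintype U] [Fintype V] [Fintype O] [Nonempty U]
    (T : S → U → V → S → ℝ) (Z : S → U → O → ℝ) (R : S → U → V → ℝ)
    (P : S → V → ℝ) (φ : ℝ) (n : ℕ) (b : S → ℝ) (u : U) : ℝ :=
  expR R P b u +
    φ * ∑ v, ∑ o, obsPr T Z P b u v o * valFun T Z R P φ n (beliefUpd T Z P b u v o)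

/-- Prediction error `ε_p = max_{s,v} |Pr*(s,v) − Pr(s,v)|`. -/
def predErr [Fintype S] [Fintype V] [Nonempty S] [Nonempty V]
    (Pstar Ppred : S → V → ℝ) : ℝ :=
  ⨆ s : S, ⨆ v : V, |Pstar s v - Ppred s v|

/-- Expected total reward of executing the (greedy) policy `π` under the true
strategy `Pstar`: `J_0(b) = 0` and
`J_{k+1}(b) = R_{P*}(b,π_{k+1}(b)) + φ Σ_{v,o} Pr_{P*}(v,o|b,π_{k+1}(b)) J_k(B_{P*}(b,π_{k+1}(b),v,o))`. -/
def execJ [Fintype S] [Fintype V] [Fintype O]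
    (T : S → U → V → S → ℝ) (Z : S → U → O → ℝ) (R : S → U → V → ℝ)
    (Pstar : S → V → ℝ) (φ : ℝ) (π : ℕ → (S → ℝ) → U) : ℕ → (S → ℝ) → ℝ
  | 0, _ => 0
  | k + 1, b =>
      expR R Pstar b (π (k + 1) b) +
        φ * ∑ v, ∑ o, obsPr T Z Pstar b (π (k + 1) b) v o *
          execJ T Z R Pstar φ π k (beliefUpd T Z Pstar b (π (k + 1) b) v o)

/-- Joint `L¹` distance of the weights `P(s,v) x(s)` and `P'(s,v) y(s)`. -/
def jointDist [Fintype S] [Fintype V] (P P' : S → V → ℝ) (x y : S → ℝ) : ℝ :=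
  ∑ v, ∑ s, |P s v * x s - P' s v * y s|

theorem jointDist_same [Fintype S] [Fintype V] {P : S → V → ℝ} (hP : IsStrategy P)
    (x y : S → ℝ) : jointDist P P x y = ∑ s, |x s - y s| := by
  unfold jointDist
  rw [Finset.sum_comm]
  refine Finset.sum_congr rfl fun s _ => ?_
  simp_rw [← mul_sub, abs_mul, abs_of_nonneg (hP.1 s _)]
  rw [← Finset.sum_mul, hP.2, one_mul]

theorem abs_sub_le_predErr [Fintype S] [Fintype V] [Nonempty S] [Nonempty V]
    (P P' : S → V → ℝ) (s : S) (v : V) : |P s v - P' s v| ≤ predErr P P' :=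
  (le_ciSup (f := fun v => |P s v - P' s v|) (Set.finite_range _).bddAbove v).trans
    (le_ciSup (f := fun s => ⨆ v, |P s v - P' s v|) (Set.finite_range _).bddAbove s)

theorem predErr_nonneg [Fintype S] [Fintype V] [Nonempty S] [Nonempty V]
    (P P' : S → V → ℝ) : 0 ≤ predErr P P' :=
  (abs_nonneg _).trans
    (abs_sub_le_predErr P P' (Classical.arbitrary S) (Classical.arbitrary V))

theorem jointDist_belief_le [Fintype S] [Fintype V] [Nonempty S] [Nonempty V]
    (Pstar P : S → V → ℝ) {b : S → ℝ} (hb : IsBelief b) :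
    jointDist P Pstar b b ≤ predErr Pstar P * Fintype.card V := by
  calc jointDist P Pstar b b ≤ ∑ _v : V, ∑ s, predErr Pstar P * b s := by
        refine Finset.sum_le_sum fun v _ => Finset.sum_le_sum fun s _ => ?_
        rw [← sub_mul, abs_mul, abs_of_nonneg (hb.1 s), abs_sub_comm]
        exact mul_le_mul_of_nonneg_right (abs_sub_le_predErr _ _ _ _) (hb.1 s)
    _ = predErr Pstar P * Fintype.card V := by
        simp_rw [← Finset.mul_sum, hb.2]
        simp

theorem abs_expR_sub_le [Fintype S] [Fintype V] {R : S → U → V → ℝ} {Rmax : ℝ}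
    (hR : ∀ s u v, 0 ≤ R s u v ∧ R s u v ≤ Rmax)
    (P P' : S → V → ℝ) (x y : S → ℝ) (u : U) :
    |expR R P x u - expR R P' y u| ≤ Rmax * jointDist P P' x y := by
  have hexp : ∀ (Q : S → V → ℝ) (z : S → ℝ),
      expR R Q z u = ∑ v, ∑ s, z s * Q s v * R s u v := fun _ _ => Finset.sum_comm
  rw [hexp, hexp, jointDist, Finset.mul_sum, ← Finset.sum_sub_distrib]
  refine (Finset.abs_sum_le_sum_abs _ _).trans (Finset.sum_le_sum fun v _ => ?_)
  rw [← Finset.sum_sub_distrib, Finset.mul_sum]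
  refine (Finset.abs_sum_le_sum_abs _ _).trans (Finset.sum_le_sum fun s _ => ?_)
  have h : x s * P s v * R s u v - y s * P' s v * R s u v
      = R s u v * (P s v * x s - P' s v * y s) := by ring
  rw [h, abs_mul, abs_of_nonneg (hR s u v).1]
  exact mul_le_mul_of_nonneg_right (hR s u v).2 (abs_nonneg _)

section Update

variable [Fintype S] {T : S → U → V → S → ℝ} {Z : S → U → O → ℝ}

theorem sum_unnormUpd (P : S → V → ℝ) (x : S → ℝ) (u : U) (v : V) (o : O) :
    ∑ s', unnormUpd T Z P x u v o s' = obsPr T Z P x u v o := rfl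

theorem unnormUpd_nonneg (hT0 : ∀ s u v s', 0 ≤ T s u v s')
    (hZ0 : ∀ s' u o, 0 ≤ Z s' u o) {P : S → V → ℝ} (hP : ∀ s v, 0 ≤ P s v)
    {x : S → ℝ} (hx : ∀ s, 0 ≤ x s) (u : U) (v : V) (o : O) (s' : S) :
    0 ≤ unnormUpd T Z P x u v o s' :=
  mul_nonneg (hZ0 _ _ _) (Finset.sum_nonneg fun _ _ =>
    mul_nonneg (mul_nonneg (hT0 _ _ _ _) (hP _ _)) (hx _))

theorem obsPr_nonneg (hT0 : ∀ s u v s', 0 ≤ T s u v s')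
    (hZ0 : ∀ s' u o, 0 ≤ Z s' u o) {P : S → V → ℝ} (hP : ∀ s v, 0 ≤ P s v)
    {x : S → ℝ} (hx : ∀ s, 0 ≤ x s) (u : U) (v : V) (o : O) :
    0 ≤ obsPr T Z P x u v o :=
  Finset.sum_nonneg fun s' _ => unnormUpd_nonneg hT0 hZ0 hP hx u v o s'

theorem isBelief_beliefUpd (hT0 : ∀ s u v s', 0 ≤ T s u v s')
    (hZ0 : ∀ s' u o, 0 ≤ Z s' u o) {P : S → V → ℝ} (hP : ∀ s v, 0 ≤ P s v)
    {x : S → ℝ} (hx : ∀ s, 0 ≤ x s) {u : U} {v : V} {o : O}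
    (h : 0 < obsPr T Z P x u v o) : IsBelief (beliefUpd T Z P x u v o) := by
  refine ⟨fun s' => div_nonneg (unnormUpd_nonneg hT0 hZ0 hP hx u v o s') h.le, ?_⟩
  unfold beliefUpd
  rw [← Finset.sum_div, sum_unnormUpd, div_self h.ne']

theorem sum_obsPr [Fintype V] [Fintype O] (hT1 : ∀ s u v, ∑ s', T s u v s' = 1)
    (hZ1 : ∀ s' u, ∑ o, Z s' u o = 1) {P : S → V → ℝ} (hP : IsStrategy P)
    {b : S → ℝ} (hb : IsBelief b) (u : U) :
    ∑ v, ∑ o, obsPr T Z P b u v o = 1 := by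
  have h : ∀ v, ∑ o, obsPr T Z P b u v o = ∑ s, P s v * b s := by
    intro v
    unfold obsPr
    rw [Finset.sum_comm]
    simp_rw [← Finset.sum_mul, hZ1, one_mul]
    rw [Finset.sum_comm]
    simp_rw [mul_assoc, ← Finset.sum_mul, hT1, one_mul]
  simp_rw [h]
  rw [Finset.sum_comm]
  simp_rw [← Finset.sum_mul, hP.2, one_mul]
  exact hb.2

theorem sum_abs_unnormUpd_sub_le [Fintype V] [Fintype O]
    (hT0 : ∀ s u v s', 0 ≤ T s u v s') (hT1 : ∀ s u v, ∑ s', T s u v s' = 1)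
    (hZ0 : ∀ s' u o, 0 ≤ Z s' u o) (hZ1 : ∀ s' u, ∑ o, Z s' u o = 1)
    (P P' : S → V → ℝ) (x y : S → ℝ) (u : U) :
    ∑ v, ∑ o, ∑ s', |unnormUpd T Z P x u v o s' - unnormUpd T Z P' y u v o s'|
      ≤ jointDist P P' x y := by
  refine Finset.sum_le_sum fun v _ => ?_
  calc ∑ o, ∑ s', |unnormUpd T Z P x u v o s' - unnormUpd T Z P' y u v o s'|
      ≤ ∑ o, ∑ s', Z s' u o * ∑ s, T s u v s' * |P s v * x s - P' s v * y s| := by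
        refine Finset.sum_le_sum fun o _ => Finset.sum_le_sum fun s' _ => ?_
        unfold unnormUpd
        rw [← mul_sub, abs_mul, abs_of_nonneg (hZ0 _ _ _), ← Finset.sum_sub_distrib]
        refine mul_le_mul_of_nonneg_left ?_ (hZ0 _ _ _)
        refine (Finset.abs_sum_le_sum_abs _ _).trans (Finset.sum_le_sum fun s _ => ?_)
        rw [mul_assoc, mul_assoc, ← mul_sub, abs_mul, abs_of_nonneg (hT0 _ _ _ _)]
    _ = ∑ s, |P s v * x s - P' s v * y s| := by
        rw [Finset.sum_comm]
        simp_rw [← Finset.sum_mul, hZ1, one_mul]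
        rw [Finset.sum_comm]
        simp_rw [← Finset.sum_mul, hT1, one_mul]

theorem unnormUpd_smul (P : S → V → ℝ) (c : ℝ) (x : S → ℝ) (u : U) (v : V) (o : O) :
    unnormUpd T Z P (c • x) u v o = c • unnormUpd T Z P x u v o := by
  funext s'
  simp only [unnormUpd, Pi.smul_apply, smul_eq_mul, Finset.mul_sum]
  exact Finset.sum_congr rfl fun s _ => by ring

theorem obsPr_smul (P : S → V → ℝ) (c : ℝ) (x : S → ℝ) (u : U) (v : V) (o : O) :
    obsPr T Z P (c • x) u v o = c * obsPr T Z P x u v o := by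
  rw [← sum_unnormUpd, ← sum_unnormUpd, unnormUpd_smul, Finset.mul_sum]
  rfl

theorem beliefUpd_smul (P : S → V → ℝ) {c : ℝ} (hc : c ≠ 0) (x : S → ℝ)
    (u : U) (v : V) (o : O) :
    beliefUpd T Z P (c • x) u v o = beliefUpd T Z P x u v o := by
  funext s'
  unfold beliefUpd
  rw [unnormUpd_smul, obsPr_smul, Pi.smul_apply, smul_eq_mul, mul_div_mul_left _ _ hc]

end Update

section Value

variable [Fintype S] [Fintype U] [Fintype V] [Fintype O] [Nonempty U]
  {T : S → U → V → S → ℝ} {Z : S → U → O → ℝ} {R : S → U → V → ℝ}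

theorem valFun_smul (P : S → V → ℝ) (φ : ℝ) (n : ℕ) {c : ℝ} (hc : 0 ≤ c) (x : S → ℝ) :
    valFun T Z R P φ n (c • x) = c * valFun T Z R P φ n x := by
  cases n with
  | zero => simp [valFun]
  | succ n =>
    simp only [valFun]
    rw [Real.mul_iSup_of_nonneg hc]
    refine iSup_congr fun u => ?_
    have hexp : expR R P (c • x) u = c * expR R P x u := by
      simp only [expR, Pi.smul_apply, smul_eq_mul, Finset.mul_sum]
      exact Finset.sum_congr rfl fun s _ => Finset.sum_congr rfl fun v _ => by ring
    have hstep : ∀ v o, obsPr T Z P (c • x) u v o *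
          valFun T Z R P φ n (beliefUpd T Z P (c • x) u v o)
        = c * (obsPr T Z P x u v o * valFun T Z R P φ n (beliefUpd T Z P x u v o)) := by
      intro v o
      rw [obsPr_smul]
      rcases eq_or_ne c 0 with rfl | hc0
      · simp
      · rw [beliefUpd_smul P hc0, mul_assoc]
    simp_rw [hexp, hstep, ← Finset.mul_sum]
    ring

theorem obsPr_mul_valFun (hT0 : ∀ s u v s', 0 ≤ T s u v s')
    (hZ0 : ∀ s' u o, 0 ≤ Z s' u o) {P : S → V → ℝ} (hP : ∀ s v, 0 ≤ P s v)
    {x : S → ℝ} (hx : ∀ s, 0 ≤ x s) (P' : S → V → ℝ) (φ : ℝ) (n : ℕ)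
    (u : U) (v : V) (o : O) :
    obsPr T Z P x u v o * valFun T Z R P' φ n (beliefUpd T Z P x u v o)
      = valFun T Z R P' φ n (unnormUpd T Z P x u v o) := by
  have h0 := obsPr_nonneg hT0 hZ0 hP hx u v o
  rw [← valFun_smul P' φ n h0]
  congr 1
  funext s'
  simp only [Pi.smul_apply, smul_eq_mul, beliefUpd]
  rcases h0.eq_or_lt with h | h
  · have hs : ∑ s', unnormUpd T Z P x u v o s' = 0 := h.symm
    rw [← h, zero_mul, (Finset.sum_eq_zero_iff_of_nonneg fun s' _ =>
      unnormUpd_nonneg hT0 hZ0 hP hx u v o s').1 hs s' (Finset.mem_univ _)]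
  · exact mul_div_cancel₀ _ h.ne'

/-- One-step lookahead value when the other agent plays `P` and the continuation value is
computed with `P'`. -/
def lookahead (T : S → U → V → S → ℝ) (Z : S → U → O → ℝ) (R : S → U → V → ℝ)
    (P P' : S → V → ℝ) (φ : ℝ) (n : ℕ) (x : S → ℝ) (u : U) : ℝ :=
  expR R P x u + φ * ∑ v, ∑ o, obsPr T Z P x u v o *
    valFun T Z R P' φ n (beliefUpd T Z P x u v o)

theorem abs_lookahead_sub_le (hT0 : ∀ s u v s', 0 ≤ T s u v s')
    (hT1 : ∀ s u v, ∑ s', T s u v s' = 1)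
    (hZ0 : ∀ s' u o, 0 ≤ Z s' u o) (hZ1 : ∀ s' u, ∑ o, Z s' u o = 1)
    {Rmax : ℝ} (hR : ∀ s u v, 0 ≤ R s u v ∧ R s u v ≤ Rmax) {φ : ℝ} (hφ0 : 0 ≤ φ)
    {P P' P'' : S → V → ℝ} (hP : ∀ s v, 0 ≤ P s v) (hP' : ∀ s v, 0 ≤ P' s v)
    {n : ℕ} {L : ℝ} (hL0 : 0 ≤ L)
    (hL : ∀ x y : S → ℝ, (∀ s, 0 ≤ x s) → (∀ s, 0 ≤ y s) →
      |valFun T Z R P'' φ n x - valFun T Z R P'' φ n y| ≤ L * ∑ s, |x s - y s|)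
    {x y : S → ℝ} (hx : ∀ s, 0 ≤ x s) (hy : ∀ s, 0 ≤ y s) (u : U) :
    |lookahead T Z R P P'' φ n x u - lookahead T Z R P' P'' φ n y u|
      ≤ (Rmax + φ * L) * jointDist P P' x y := by
  have hcont : |∑ v, ∑ o, valFun T Z R P'' φ n (unnormUpd T Z P x u v o)
      - ∑ v, ∑ o, valFun T Z R P'' φ n (unnormUpd T Z P' y u v o)|
      ≤ L * jointDist P P' x y := by
    refine le_trans ?_ (mul_le_mul_of_nonneg_left
      (sum_abs_unnormUpd_sub_le hT0 hT1 hZ0 hZ1 P P' x y u) hL0)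
    rw [← Finset.sum_sub_distrib, Finset.mul_sum]
    refine (Finset.abs_sum_le_sum_abs _ _).trans (Finset.sum_le_sum fun v _ => ?_)
    rw [← Finset.sum_sub_distrib, Finset.mul_sum]
    refine (Finset.abs_sum_le_sum_abs _ _).trans (Finset.sum_le_sum fun o _ => ?_)
    exact hL _ _ (unnormUpd_nonneg hT0 hZ0 hP hx u v o) (unnormUpd_nonneg hT0 hZ0 hP' hy u v o)
  unfold lookahead
  simp_rw [obsPr_mul_valFun hT0 hZ0 hP hx, obsPr_mul_valFun hT0 hZ0 hP' hy]
  rw [add_sub_add_comm, ← mul_sub]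
  refine (abs_add_le _ _).trans ?_
  rw [abs_mul, abs_of_nonneg hφ0, add_mul, mul_assoc]
  exact add_le_add (abs_expR_sub_le hR P P' x y u) (mul_le_mul_of_nonneg_left hcont hφ0)

theorem abs_ciSup_sub_ciSup_le {ι : Type*} [Finite ι] [Nonempty ι] {f g : ι → ℝ} {K : ℝ}
    (h : ∀ i, |f i - g i| ≤ K) : |(⨆ i, f i) - ⨆ i, g i| ≤ K := by
  rw [abs_sub_le_iff, sub_le_iff_le_add', sub_le_iff_le_add']
  constructor <;> refine ciSup_le fun i => ?_
  · linarith [(abs_sub_le_iff.1 (h i)).1, le_ciSup (Set.finite_range g).bddAbove i]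
  · linarith [(abs_sub_le_iff.1 (h i)).2, le_ciSup (Set.finite_range f).bddAbove i]

/-- The value functions are `Rmax / (1 - φ)`-Lipschitz for the `L¹` norm on the nonnegative cone. -/
theorem abs_valFun_sub_le (hT0 : ∀ s u v s', 0 ≤ T s u v s')
    (hT1 : ∀ s u v, ∑ s', T s u v s' = 1)
    (hZ0 : ∀ s' u o, 0 ≤ Z s' u o) (hZ1 : ∀ s' u, ∑ o, Z s' u o = 1)
    {Rmax : ℝ} (hRmax : 0 ≤ Rmax) (hR : ∀ s u v, 0 ≤ R s u v ∧ R s u v ≤ Rmax)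
    {φ : ℝ} (hφ0 : 0 ≤ φ) (hφ1 : φ < 1) {P : S → V → ℝ} (hP : IsStrategy P) (n : ℕ) :
    ∀ x y : S → ℝ, (∀ s, 0 ≤ x s) → (∀ s, 0 ≤ y s) →
      |valFun T Z R P φ n x - valFun T Z R P φ n y| ≤ Rmax / (1 - φ) * ∑ s, |x s - y s| := by
  have hφ : 0 < 1 - φ := sub_pos.2 hφ1
  have hL0 : 0 ≤ Rmax / (1 - φ) := div_nonneg hRmax hφ.le
  induction n with
  | zero =>
    intro x y _ _
    simpa [valFun] using mul_nonneg hL0 (Finset.sum_nonneg fun s _ => abs_nonneg (x s - y s))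
  | succ n ih =>
    intro x y hx hy
    simp only [valFun]
    refine abs_ciSup_sub_ciSup_le fun u => ?_
    have h := abs_lookahead_sub_le hT0 hT1 hZ0 hZ1 hR hφ0 hP.1 hP.1 hL0 ih hx hy u
    rw [jointDist_same hP, show Rmax + φ * (Rmax / (1 - φ)) = Rmax / (1 - φ) by
      field_simp; ring] at h
    exact h

theorem valFun_succ_of_greedy {P : S → V → ℝ} {φ : ℝ} {n : ℕ} {b : S → ℝ} {a : U}
    (ha : ∀ u, qFun T Z R P φ n b u ≤ qFun T Z R P φ n b a) :
    valFun T Z R P φ (n + 1) b = qFun T Z R P φ n b a :=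
  le_antisymm (ciSup_le ha)
    (le_ciSup (f := qFun T Z R P φ n b) (Set.finite_range _).bddAbove a)

end Value

/-- The expected total reward of the greedy I-POMDP Lite policy evaluated under the
true strategy differs from the value function computed under the predicted strategy
by at most `ε_p |V| R_max [φ^{n−1} + (1/(1−φ))(1 + 3φ|O|/(1−φ))]`. -/
theorem ipomdp_lite_greedy_policy_value_diff
    [Fintype S] [Fintype U] [Fintype V] [Fintype O]
    [Nonempty S] [Nonempty U] [Nonempty V] [Nonempty O]
    (T : S → U → V → S → ℝ) (Z : S → U → O → ℝ) (R : S → U → V → ℝ)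
    (Pstar Ppred : S → V → ℝ) (φ : ℝ) (Rmax : ℝ)
    (hT0 : ∀ s u v s', 0 ≤ T s u v s') (hT1 : ∀ s u v, ∑ s', T s u v s' = 1)
    (hZ0 : ∀ s' u o, 0 ≤ Z s' u o) (hZ1 : ∀ s' u, ∑ o, Z s' u o = 1)
    (hR : ∀ s u v, 0 ≤ R s u v ∧ R s u v ≤ Rmax)
    (hφ0 : 0 < φ) (hφ1 : φ < 1)
    (hPstar : IsStrategy Pstar) (hPpred : IsStrategy Ppred)
    (n : ℕ) (hn : 1 ≤ n)
    (π : ℕ → (S → ℝ) → U)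
    (hπ : ∀ k, 1 ≤ k → k ≤ n → ∀ b : S → ℝ, IsBelief b →
      ∀ u : U, qFun T Z R Ppred φ (k - 1) b u ≤ qFun T Z R Ppred φ (k - 1) b (π k b)) :
    ∀ b : S → ℝ, IsBelief b →
      |valFun T Z R Ppred φ n b - execJ T Z R Pstar φ π n b| ≤
        predErr Pstar Ppred * (Fintype.card V) * Rmax *
          (φ ^ (n - 1) + (1 / (1 - φ)) * (1 + 3 * φ * (Fintype.card O) / (1 - φ))) := by
  have hφ : 0 < 1 - φ := sub_pos.2 hφ1
  have hRmax : 0 ≤ Rmax :=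
    have h := hR (Classical.arbitrary S) (Classical.arbitrary U) (Classical.arbitrary V)
    h.1.trans h.2
  have hL0 : 0 ≤ Rmax / (1 - φ) := div_nonneg hRmax hφ.le
  set C := predErr Pstar Ppred * (Fintype.card V) with hC
  have hC0 : 0 ≤ C := mul_nonneg (predErr_nonneg _ _) (Nat.cast_nonneg _)
  set K := C * Rmax / (1 - φ) ^ 2 with hK
  have hK0 : 0 ≤ K := by positivity
  have main : ∀ k ≤ n, ∀ b : S → ℝ, IsBelief b →
      |valFun T Z R Ppred φ k b - execJ T Z R Pstar φ π k b| ≤ K := by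
    intro k
    induction k with
    | zero => intro _ b _; simpa [valFun, execJ] using hK0
    | succ k ih =>
      intro hk b hb
      have ih := ih (by omega)
      set a := π (k + 1) b with ha
      have hval : valFun T Z R Ppred φ (k + 1) b = lookahead T Z R Ppred Ppred φ k b a :=
        valFun_succ_of_greedy (hπ (k + 1) (by omega) hk b hb)
      have hmodel : |lookahead T Z R Ppred Ppred φ k b a - lookahead T Z R Pstar Ppred φ k b a|
          ≤ Rmax / (1 - φ) * C := by
        have h := abs_lookahead_sub_le hT0 hT1 hZ0 hZ1 hR hφ0.le hPpred.1 hPstar.1 hL0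
          (abs_valFun_sub_le hT0 hT1 hZ0 hZ1 hRmax hR hφ0.le hφ1 hPpred k) hb.1 hb.1 a
        rw [show Rmax + φ * (Rmax / (1 - φ)) = Rmax / (1 - φ) by field_simp; ring] at h
        exact h.trans (mul_le_mul_of_nonneg_left (jointDist_belief_le Pstar Ppred hb) hL0)
      have hcont : |lookahead T Z R Pstar Ppred φ k b a - execJ T Z R Pstar φ π (k + 1) b|
          ≤ φ * K := by
        simp only [lookahead, execJ]
        rw [← ha, add_sub_add_left_eq_sub, ← mul_sub, abs_mul, abs_of_pos hφ0]
        refine mul_le_mul_of_nonneg_left ?_ hφ0.le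
        rw [← one_mul K, ← sum_obsPr hT1 hZ1 hPstar hb a, ← Finset.sum_sub_distrib,
          Finset.sum_mul]
        refine (Finset.abs_sum_le_sum_abs _ _).trans (Finset.sum_le_sum fun v _ => ?_)
        rw [← Finset.sum_sub_distrib, Finset.sum_mul]
        refine (Finset.abs_sum_le_sum_abs _ _).trans (Finset.sum_le_sum fun o _ => ?_)
        have h0 := obsPr_nonneg hT0 hZ0 hPstar.1 hb.1 a v o
        rw [← mul_sub, abs_mul, abs_of_nonneg h0]
        rcases h0.eq_or_lt with h | h
        · simp [← h]
        · exact mul_le_mul_of_nonneg_left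
            (ih _ (isBelief_beliefUpd hT0 hZ0 hPstar.1 hb.1 h)) h0
      have hrec : Rmax / (1 - φ) * C + φ * K = K := by
        rw [hK]; field_simp; ring
      rw [hval]
      exact (abs_sub_le _ _ _).trans ((add_le_add hmodel hcont).trans_eq hrec)
  intro b hb
  refine (main n le_rfl b hb).trans ?_
  have hO : (1 : ℝ) ≤ Fintype.card O := by exact_mod_cast Fintype.card_pos
  have hbound : 1 / (1 - φ) ^ 2 ≤
      φ ^ (n - 1) + (1 / (1 - φ)) * (1 + 3 * φ * (Fintype.card O) / (1 - φ)) := by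
    have h1 : 1 / (1 - φ) ^ 2 = 1 / (1 - φ) * (1 + φ / (1 - φ)) := by field_simp; ring
    have h2 : φ / (1 - φ) ≤ 3 * φ * (Fintype.card O) / (1 - φ) :=
      div_le_div_of_nonneg_right (by nlinarith) hφ.le
    have h3 : 1 / (1 - φ) * (1 + φ / (1 - φ)) ≤
        1 / (1 - φ) * (1 + 3 * φ * (Fintype.card O) / (1 - φ)) :=
      mul_le_mul_of_nonneg_left (by linarith) (by positivity)
    have h4 : 0 ≤ φ ^ (n - 1) := by positivity
    linarith
  rw [hK, div_eq_mul_one_div]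
  exact mul_le_mul_of_nonneg_left hbound (mul_nonneg hC0 hRmax)
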